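/- Let n ≥ 3 be a natural number and define ψ : ℝⁿ → ℝ by ψ(x) = ((1 + |x|²)/2)^{(2−n)/2}, where |x| is the Euclidean norm. Then for every smooth compactly supported function w : ℝⁿ → ℝ with w not identically zero: (∫_{ℝⁿ} |∇w(x)|² dx) / (∫_{ℝⁿ} |w(x)|^{2n/(n−2)} dx)^{(n−2)/n} ≥ (∫_{ℝⁿ} |∇ψ(x)|² dx) / (∫_{ℝⁿ} ψ(x)^{2n/(n−2)} dx)^{(n−2)/n}, where ∇ denotes the (Fréchet) gradient and the integrals are Lebesgue integrals over ℝⁿ. -/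

import Mathlib

open MeasureTheory

section
open Set Filter Topology ENNReal

theorem hasDerivAt_setIntegral_Iic {f : ℝ → ℝ} (hf : Continuous f) (hfi : Integrable f) (t : ℝ) :
    HasDerivAt (fun s => ∫ u in Iic s, f u) (f t) t := by
  have h : ∀ s, ∫ u in Iic s, f u = (∫ u in Iic t, f u) + ∫ u in t..s, f u := fun s => by
    rw [← intervalIntegral.integral_Iic_sub_Iic hfi.integrableOn hfi.integrableOn]; ring
  rw [funext h]
  exact (intervalIntegral.integral_hasDerivAt_right (hf.intervalIntegrable _ _)
    (hf.stronglyMeasurableAtFilter _ _) hf.continuousAt).const_add _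

theorem strictMono_setIntegral_Iic {f : ℝ → ℝ} (hf : Continuous f) (hfi : Integrable f)
    (hf0 : ∀ t, 0 < f t) : StrictMono (fun s => ∫ u in Iic s, f u) :=
  strictMono_of_deriv_pos fun t => by
    rw [(hasDerivAt_setIntegral_Iic hf hfi t).deriv]; exact hf0 t

theorem exists_setIntegral_Iic_eq {f g : ℝ → ℝ} (hf : Continuous f) (hg : Continuous g)
    (hfi : Integrable f) (hgi : Integrable g) (hf0 : ∀ t, 0 < f t)
    (hfg : ∫ t, f t = ∫ t, g t) (t : ℝ) :
    ∃ s, ∫ u in Iic s, g u = ∫ u in Iic t, f u := by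
  have hA := strictMono_setIntegral_Iic hf hfi hf0
  have h1 : 0 < ∫ u in Iic t, f u :=
    lt_of_le_of_lt (setIntegral_nonneg measurableSet_Iic fun u _ => (hf0 u).le)
      (hA (sub_one_lt t))
  have h2 : ∫ u in Iic t, f u < ∫ u, g u := by
    rw [← hfg]
    exact (hA (lt_add_one t)).trans_le
      (setIntegral_le_integral hfi (Eventually.of_forall fun u => (hf0 u).le))
  have hB : Continuous (fun s => ∫ u in Iic s, g u) :=
    continuous_iff_continuousAt.2 fun s => (hasDerivAt_setIntegral_Iic hg hgi s).continuousAt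
  have hbot : Tendsto (fun s => ∫ u in Iic s, g u) atBot (𝓝 0) :=
    tendsto_integral_Iic_zero tendsto_id
  have htop : Tendsto (fun s => ∫ u in Iic s, g u) atTop (𝓝 (∫ u, g u)) := by
    have := (aecover_Iic (μ := volume) (tendsto_id (α := ℝ) (x :=
      atTop))).integral_tendsto_of_countably_generated hgi
    exact this
  obtain ⟨a, ha⟩ := (hbot.eventually (gt_mem_nhds h1)).exists
  obtain ⟨b, hb⟩ := (htop.eventually (lt_mem_nhds h2)).exists
  exact mem_range_of_exists_le_of_exists_ge hB ⟨a, ha.le⟩ ⟨b, hb.le⟩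

/-- The monotone rearrangement between two positive continuous densities on the line. -/
theorem exists_monotone_transport {f g : ℝ → ℝ} (hf : Continuous f) (hg : Continuous g)
    (hfi : Integrable f) (hgi : Integrable g) (hf0 : ∀ t, 0 < f t) (hg0 : ∀ t, 0 < g t)
    (hfg : ∫ t, f t = ∫ t, g t) :
    ∃ τ : ℝ → ℝ, (∀ t s, τ t ≤ s ↔ ∫ u in Iic t, f u ≤ ∫ u in Iic s, g u) ∧
      (∀ t, HasDerivAt τ (f t / g (τ t)) t) ∧
      ∀ φ : ℝ → ℝ≥0∞, ∫⁻ t, φ (τ t) * ENNReal.ofReal (f t) = ∫⁻ s, φ s * ENNReal.ofReal (g s) := by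
  have hA := strictMono_setIntegral_Iic hf hfi hf0
  have hB := strictMono_setIntegral_Iic hg hgi hg0
  choose τ hτ using exists_setIntegral_Iic_eq hf hg hfi hgi hf0 hfg
  have hmono : StrictMono τ := fun a b hab => by
    rw [← hB.lt_iff_lt]; simp only [hτ]; exact hA hab
  have hsurj : Function.Surjective τ := fun s => by
    obtain ⟨t, ht⟩ := exists_setIntegral_Iic_eq hg hf hgi hfi hg0 hfg.symm s
    exact ⟨t, hB.injective (by simp only [hτ, ht])⟩
  have hcont : Continuous τ := hmono.monotone.continuous_of_surjective hsurj
  have hderiv : ∀ t, HasDerivAt τ (f t / g (τ t)) t := fun t => by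
    have h1 := hasDerivAt_iff_tendsto_slope.1 (hasDerivAt_setIntegral_Iic hf hfi t)
    have h2 := hasDerivAt_iff_tendsto_slope.1 (hasDerivAt_setIntegral_Iic hg hgi (τ t))
    have h3 : Tendsto τ (𝓝[≠] t) (𝓝[≠] (τ t)) :=
      tendsto_nhdsWithin_iff.2 ⟨hcont.continuousAt.mono_left nhdsWithin_le_nhds,
        eventually_mem_nhdsWithin.mono fun s hs => hmono.injective.ne hs⟩
    rw [hasDerivAt_iff_tendsto_slope]
    refine (h1.div (h2.comp h3) (hg0 _).ne').congr' ?_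
    filter_upwards [self_mem_nhdsWithin] with s hs
    have h4 : τ s - τ t ≠ 0 := sub_ne_zero.2 (hmono.injective.ne hs)
    have h5 : s - t ≠ 0 := sub_ne_zero.2 hs
    have h6 : (∫ u in Iic s, f u) - ∫ u in Iic t, f u ≠ 0 := sub_ne_zero.2 (hA.injective.ne hs)
    simp only [Function.comp, Pi.div_apply, slope_def_field, hτ]
    field_simp
  refine ⟨τ, fun t s => ?_, hderiv, fun φ => ?_⟩
  · rw [← hB.le_iff_le]; simp only [hτ]
  · have := lintegral_image_eq_lintegral_abs_deriv_mul MeasurableSet.univ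
      (fun t _ => (hderiv t).hasDerivWithinAt) (hmono.injective.injOn)
      (fun s => φ s * ENNReal.ofReal (g s))
    rw [image_univ, hsurj.range_eq] at this
    simp only [Measure.restrict_univ] at this
    rw [this]
    refine lintegral_congr fun t => ?_
    rw [mul_left_comm, abs_of_pos (div_pos (hf0 _) (hg0 _)),
      ← ENNReal.ofReal_mul (div_pos (hf0 _) (hg0 _)).le, div_mul_cancel₀ _ (hg0 _).ne']
end

section
open Set Filter Topology ENNReal Function

/-- Positive continuous functions with product decay, a class stable under taking marginals. -/
structure IsTameDensity {n : ℕ} (F : (Fin n → ℝ) → ℝ) : Prop where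
  continuous : Continuous F
  pos : ∀ x, 0 < F x
  bound : ∃ C, ∀ x, F x ≤ C * ∏ i, (1 + x i ^ 2)⁻¹

/-- Integrating out the first coordinate. -/
noncomputable def marginalTail {n : ℕ} (F : (Fin (n + 1) → ℝ) → ℝ) (y : Fin n → ℝ) : ℝ :=
  ∫ t : ℝ, F (Fin.cons t y)

theorem lintegral_fin_succ {n : ℕ} {f : (Fin (n + 1) → ℝ) → ℝ≥0∞} (hf : Measurable f) :
    ∫⁻ x, f x = ∫⁻ y : Fin n → ℝ, ∫⁻ t : ℝ, f (Fin.cons t y) := by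
  have h := (volume_preserving_piFinSuccAbove (fun _ : Fin (n + 1) => ℝ) 0).symm
  rw [← h.lintegral_comp hf, Measure.volume_eq_prod, lintegral_prod_symm]
  · refine lintegral_congr fun y => lintegral_congr fun t => ?_
    congr 1
    simp [MeasurableEquiv.piFinSuccAbove]
    rfl
  · exact (hf.comp h.measurable).aemeasurable

theorem continuous_fin_cons {n : ℕ} :
    Continuous fun p : ℝ × (Fin n → ℝ) => (Fin.cons p.1 p.2 : Fin (n + 1) → ℝ) := by
  refine continuous_pi fun i => ?_
  refine Fin.cases ?_ (fun j => ?_) i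
  · simpa using continuous_fst
  · simp only [Fin.cons_succ]; fun_prop

namespace IsTameDensity

variable {n : ℕ} {F : (Fin (n + 1) → ℝ) → ℝ}

theorem continuous_cons (hF : IsTameDensity F) (y : Fin n → ℝ) :
    Continuous fun t : ℝ => F (Fin.cons t y) :=
  hF.continuous.comp (continuous_fin_cons.comp (by fun_prop : Continuous fun t : ℝ => (t, y)))

theorem exists_bound_cons (hF : IsTameDensity F) :
    ∃ C, 0 ≤ C ∧ ∀ (t : ℝ) (y : Fin n → ℝ),
      F (Fin.cons t y) ≤ C * (1 + t ^ 2)⁻¹ * ∏ i, (1 + y i ^ 2)⁻¹ := by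
  obtain ⟨C, hC⟩ := hF.bound
  have h : ∀ (t : ℝ) (y : Fin n → ℝ),
      F (Fin.cons t y) ≤ C * (1 + t ^ 2)⁻¹ * ∏ i, (1 + y i ^ 2)⁻¹ := fun t y => by
    refine (hC _).trans_eq ?_
    rw [Fin.prod_univ_succ]
    simp [mul_assoc]
  refine ⟨C, ?_, h⟩
  have := (hF.pos (Fin.cons 0 0)).trans_le (h 0 0)
  simpa using this.le

theorem integrable_cons (hF : IsTameDensity F) (y : Fin n → ℝ) :
    Integrable fun t : ℝ => F (Fin.cons t y) := by
  obtain ⟨C, hC0, hC⟩ := hF.exists_bound_cons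
  refine ((integrable_inv_one_add_sq.const_mul C).mul_const (∏ i, (1 + y i ^ 2)⁻¹)).mono'
    (hF.continuous_cons y).aestronglyMeasurable (Eventually.of_forall fun t => ?_)
  rw [Real.norm_of_nonneg (hF.pos _).le]
  exact hC t y

theorem marginalTail_pos (hF : IsTameDensity F) (y : Fin n → ℝ) : 0 < marginalTail F y :=
  integral_pos_of_integrable_nonneg_nonzero (x := 0) (hF.continuous_cons y) (hF.integrable_cons y)
    (fun _ => (hF.pos _).le) (hF.pos _).ne'

theorem marginalTail (hF : IsTameDensity F) : IsTameDensity (marginalTail F) := by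
  obtain ⟨C, hC0, hC⟩ := hF.exists_bound_cons
  refine ⟨?_, hF.marginalTail_pos, C * ∫ t : ℝ, (1 + t ^ 2)⁻¹, fun y => ?_⟩
  · refine continuous_of_dominated (bound := fun t => C * (1 + t ^ 2)⁻¹)
      (fun y => (hF.continuous_cons y).aestronglyMeasurable)
      (fun y => Eventually.of_forall fun t => ?_) (integrable_inv_one_add_sq.const_mul C)
      (Eventually.of_forall fun t => hF.continuous.comp
        (continuous_fin_cons.comp (by fun_prop : Continuous fun y : Fin n → ℝ => (t, y))))
    rw [Real.norm_of_nonneg (hF.pos _).le]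
    refine (hC t y).trans (mul_le_of_le_one_right (by positivity) ?_)
    exact Finset.prod_le_one (fun i _ => by positivity)
      fun i _ => inv_le_one_of_one_le₀ (by nlinarith [sq_nonneg (y i)])
  · rw [← integral_const_mul, ← integral_mul_const]
    exact integral_mono (hF.integrable_cons y)
      ((integrable_inv_one_add_sq.const_mul C).mul_const _) fun t => hC t y

theorem lintegral_cons (hF : IsTameDensity F) (y : Fin n → ℝ) :
    ∫⁻ t : ℝ, ENNReal.ofReal (F (Fin.cons t y)) = ENNReal.ofReal (_root_.marginalTail F y) :=
  (ofReal_integral_eq_lintegral_ofReal (hF.integrable_cons y)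
    (Eventually.of_forall fun _ => (hF.pos _).le)).symm

theorem lintegral_marginalTail (hF : IsTameDensity F) :
    ∫⁻ y, ENNReal.ofReal (_root_.marginalTail F y) = ∫⁻ x, ENNReal.ofReal (F x) := by
  rw [lintegral_fin_succ hF.continuous.measurable.ennreal_ofReal]
  simp_rw [hF.lintegral_cons]

theorem measurable_cdf (hF : IsTameDensity F) :
    Measurable fun p : (Fin n → ℝ) × ℝ => ∫ u in Iic p.2, F (Fin.cons u p.1) := by
  have h : (fun p : (Fin n → ℝ) × ℝ => ∫ u in Iic p.2, F (Fin.cons u p.1)) =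
      fun p => ∫ u, {q : ((Fin n → ℝ) × ℝ) × ℝ | q.2 ≤ q.1.2}.indicator
        (fun q => F (Fin.cons q.2 q.1.1)) (p, u) := by
    ext p
    rw [← integral_indicator measurableSet_Iic]
    rfl
  rw [h]
  refine (StronglyMeasurable.integral_prod_right' ?_).measurable
  refine Measurable.stronglyMeasurable (Measurable.indicator ?_ ?_)
  · exact (hF.continuous.comp (continuous_fin_cons.comp
      (by fun_prop : Continuous fun q : ((Fin n → ℝ) × ℝ) × ℝ => (q.2, q.1.1)))).measurable
  · exact measurableSet_le (by fun_prop) (by fun_prop)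

end IsTameDensity

/-- A triangular transport of `F` onto `G`: `l x i` is the `i`-th diagonal entry of the derivative
of the map `T` at `x`. -/
structure IsTriangularTransport {n : ℕ} (F G : (Fin n → ℝ) → ℝ) (T l : (Fin n → ℝ) → Fin n → ℝ) :
    Prop where
  measurable : Measurable T
  measurable_diag : Measurable l
  diag_nonneg : ∀ x i, 0 ≤ l x i
  density_eq : ∀ x, F x = (∏ i, l x i) * G (T x)
  hasDerivAt : ∀ x i, HasDerivAt (fun s => T (update x i s) i) (l x i) (x i)
  continuous_diag : ∀ x i, Continuous fun s => l (update x i s) i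
  lintegral_comp : ∀ φ : (Fin n → ℝ) → ℝ≥0∞, Measurable φ →
    ∫⁻ x, φ (T x) * ENNReal.ofReal (F x) = ∫⁻ x, φ x * ENNReal.ofReal (G x)

theorem exists_fiber_transport {n : ℕ} {F G : (Fin (n + 1) → ℝ) → ℝ} (hF : IsTameDensity F)
    (hG : IsTameDensity G) {S : (Fin n → ℝ) → Fin n → ℝ} (hS : Measurable S) :
    ∃ τ : (Fin n → ℝ) → ℝ → ℝ, Measurable (uncurry τ) ∧
      (∀ y t, HasDerivAt (τ y) (F (Fin.cons t y) / marginalTail F y /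
        (G (Fin.cons (τ y t) (S y)) / marginalTail G (S y))) t) ∧
      ∀ y (φ : ℝ → ℝ≥0∞),
        ∫⁻ t, φ (τ y t) * ENNReal.ofReal (F (Fin.cons t y)) =
        ENNReal.ofReal (marginalTail F y) * (ENNReal.ofReal (marginalTail G (S y)))⁻¹ *
          ∫⁻ s, φ s * ENNReal.ofReal (G (Fin.cons s (S y))) := by
  have key := fun y => exists_monotone_transport
    (f := fun t => F (Fin.cons t y) / marginalTail F y)
    (g := fun s => G (Fin.cons s (S y)) / marginalTail G (S y))
    ((hF.continuous_cons y).div_const _) ((hG.continuous_cons (S y)).div_const _)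
    ((hF.integrable_cons y).div_const _) ((hG.integrable_cons (S y)).div_const _)
    (fun t => div_pos (hF.pos _) (hF.marginalTail_pos y))
    (fun t => div_pos (hG.pos _) (hG.marginalTail_pos (S y)))
    (by
      rw [integral_div, integral_div]
      exact (div_self (hF.marginalTail_pos y).ne').trans
        (div_self (hG.marginalTail_pos (S y)).ne').symm)
  choose τ h1 h2 h3 using key
  refine ⟨τ, ?_, h2, fun y φ => ?_⟩
  · refine measurable_of_Iic fun s => ?_
    have : uncurry τ ⁻¹' Iic s = {p | (∫ u in Iic p.2, F (Fin.cons u p.1)) / marginalTail F p.1 ≤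
        (∫ u in Iic s, G (Fin.cons u (S p.1))) / marginalTail G (S p.1)} := by
      ext ⟨y, t⟩
      simp only [mem_preimage, mem_Iic, mem_ofPred_eq, uncurry]
      rw [h1, integral_div, integral_div]
    rw [this]
    refine measurableSet_le (hF.measurable_cdf.div
      (hF.marginalTail.continuous.measurable.comp measurable_fst)) (Measurable.div ?_ ?_)
    · exact hG.measurable_cdf.comp ((hS.comp measurable_fst).prodMk measurable_const)
    · exact hG.marginalTail.continuous.measurable.comp (hS.comp measurable_fst)
  · have hp := hF.marginalTail_pos y
    have hq := hG.marginalTail_pos (S y)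
    have h := h3 y φ
    simp only [ENNReal.ofReal_div_of_pos hp, ENNReal.ofReal_div_of_pos hq] at h
    simp only [div_eq_mul_inv, ← mul_assoc] at h
    have hi : ∀ a : ℝ, 0 < a → (ENNReal.ofReal a)⁻¹ ≠ ∞ := fun a ha => by simp [ha]
    rw [lintegral_mul_const' _ _ (hi _ hp), lintegral_mul_const' _ _ (hi _ hq)] at h
    rw [mul_assoc, mul_comm (ENNReal.ofReal (marginalTail G (S y)))⁻¹, ← h, mul_comm,
      mul_assoc, ENNReal.inv_mul_cancel (by simp [hp]) (by simp), mul_one]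

/-- The Knothe rearrangement. -/
theorem exists_isTriangularTransport : ∀ {n : ℕ} {F G : (Fin n → ℝ) → ℝ}, IsTameDensity F →
    IsTameDensity G → ∫⁻ x, ENNReal.ofReal (F x) = ∫⁻ x, ENNReal.ofReal (G x) →
    ∃ T l, IsTriangularTransport F G T l
  | 0, F, G, hF, hG, h => by
    have hFG : F = G := by
      ext x
      rw [Measure.volume_pi_eq_dirac x, lintegral_dirac, lintegral_dirac,
        ENNReal.ofReal_eq_ofReal_iff (hF.pos x).le (hG.pos x).le] at h
      exact h
    subst hFG
    exact ⟨id, fun _ _ => 1, measurable_id, measurable_const, fun _ _ => zero_le_one, by simp,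
      fun _ i => i.elim0, fun _ i => i.elim0, fun _ _ => rfl⟩
  | n + 1, F, G, hF, hG, h => by
    obtain ⟨S, m, hS⟩ := exists_isTriangularTransport hF.marginalTail hG.marginalTail
      (by rw [hF.lintegral_marginalTail, hG.lintegral_marginalTail, h])
    obtain ⟨τ, hτ, hτd, hτi⟩ := exists_fiber_transport hF hG hS.measurable
    have htail : Measurable (Fin.tail : (Fin (n + 1) → ℝ) → Fin n → ℝ) :=
      measurable_pi_lambda _ fun i => measurable_pi_apply _
    have hST : Measurable fun x : Fin (n + 1) → ℝ => S (Fin.tail x) := hS.measurable.comp htail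
    have hτx : Measurable fun x : Fin (n + 1) → ℝ => τ (Fin.tail x) (x 0) :=
      hτ.comp (htail.prodMk (measurable_pi_apply 0))
    have hcons := (continuous_fin_cons (n := n)).measurable
    have hT : Measurable fun x : Fin (n + 1) → ℝ =>
        (Fin.cons (τ (Fin.tail x) (x 0)) (S (Fin.tail x)) : Fin (n + 1) → ℝ) :=
      hcons.comp (hτx.prodMk hST)
    let l₀ : (Fin (n + 1) → ℝ) → ℝ := fun x => F x / marginalTail F (Fin.tail x) /
      (G (Fin.cons (τ (Fin.tail x) (x 0)) (S (Fin.tail x))) / marginalTail G (S (Fin.tail x)))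
    refine ⟨fun x => Fin.cons (τ (Fin.tail x) (x 0)) (S (Fin.tail x)),
      fun x => Fin.cons (l₀ x) (m (Fin.tail x)), hT, ?_, ?_, ?_, ?_, ?_, ?_⟩
    · refine hcons.comp (Measurable.prodMk ?_ (hS.measurable_diag.comp htail))
      exact (hF.continuous.measurable.div (hF.marginalTail.continuous.measurable.comp htail)).div
        ((hG.continuous.measurable.comp hT).div (hG.marginalTail.continuous.measurable.comp hST))
    · intro x i
      refine Fin.cases ?_ (fun j => ?_) i
      · simp only [Fin.cons_zero]
        exact (div_pos (div_pos (hF.pos _) (hF.marginalTail_pos _))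
          (div_pos (hG.pos _) (hG.marginalTail_pos _))).le
      · simpa using hS.diag_nonneg _ j
    · intro x
      have h1 := hS.density_eq (Fin.tail x)
      have h2 := hF.marginalTail_pos (Fin.tail x)
      have h3 := hG.marginalTail_pos (S (Fin.tail x))
      have h4 := hG.pos (Fin.cons (τ (Fin.tail x) (x 0)) (S (Fin.tail x)))
      rw [Fin.prod_univ_succ]
      simp only [Fin.cons_zero, Fin.cons_succ, l₀]
      field_simp
      rw [h1]
      ring
    · intro x i
      refine Fin.cases ?_ (fun j => ?_) i
      · simpa [l₀, Fin.cons_self_tail] using hτd (Fin.tail x) (x 0)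
      · simpa [Fin.tail] using hS.hasDerivAt (Fin.tail x) j
    · intro x i
      refine Fin.cases ?_ (fun j => ?_) i
      · have hc : Continuous (τ (Fin.tail x)) :=
          continuous_iff_continuousAt.2 fun t => (hτd (Fin.tail x) t).continuousAt
        simp only [Fin.cons_zero, l₀, Fin.tail_update_zero, update_self]
        refine Continuous.div ((hF.continuous.comp (by fun_prop)).div_const _)
          (((hG.continuous_cons _).comp hc).div_const _) fun s => ?_
        exact (div_pos (hG.pos _) (hG.marginalTail_pos _)).ne'
      · simpa using hS.continuous_diag (Fin.tail x) j
    · intro φ hφ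
      have hFm := hF.continuous.measurable.ennreal_ofReal
      have hGm := hG.continuous.measurable.ennreal_ofReal
      rw [lintegral_fin_succ (by fun_prop), lintegral_fin_succ (by fun_prop)]
      simp only [Fin.tail_cons, Fin.cons_zero]
      simp_rw [fun y => hτi y fun t => φ (Fin.cons t (S y))]
      have hmeas : Measurable fun z : Fin n → ℝ =>
          ∫⁻ t : ℝ, φ (Fin.cons t z) * ENNReal.ofReal (G (Fin.cons t z)) :=
        Measurable.lintegral_prod_right'
          (f := fun p : (Fin n → ℝ) × ℝ =>
            φ (Fin.cons p.2 p.1) * ENNReal.ofReal (G (Fin.cons p.2 p.1)))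
          ((hφ.mul hGm).comp (hcons.comp measurable_swap))
      have hGt := hG.marginalTail.continuous.measurable.ennreal_ofReal
      have := hS.lintegral_comp (fun z => (ENNReal.ofReal (marginalTail G z))⁻¹ *
        ∫⁻ t : ℝ, φ (Fin.cons t z) * ENNReal.ofReal (G (Fin.cons t z))) (hGt.inv.mul hmeas)
      calc _ = _ := lintegral_congr fun y => by rw [mul_comm (ENNReal.ofReal _), mul_right_comm]
        _ = _ := this
        _ = _ := lintegral_congr fun z => by
          have hz := hG.marginalTail_pos z
          rw [mul_right_comm, ENNReal.inv_mul_cancel (by simp [hz]) (by simp), one_mul]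
end

section
open Set Filter Topology ENNReal Function

theorem integral_mul_le_of_hasCompactSupport {u l v v' : ℝ → ℝ} (hu : ∀ s, HasDerivAt u (l s) s)
    (hl : Continuous l) (hv : ∀ s, HasDerivAt v (v' s) s) (hv' : Continuous v')
    (hsupp : HasCompactSupport v) (hl0 : ∀ s, 0 ≤ l s) (hv0 : ∀ s, 0 ≤ v s) :
    ∫⁻ s, ENNReal.ofReal (l s * v s) ≤ ∫⁻ s, ENNReal.ofReal (|u s| * |v' s|) := by
  have huc : Continuous u := continuous_iff_continuousAt.2 fun s => (hu s).continuousAt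
  have hvc : Continuous v := continuous_iff_continuousAt.2 fun s => (hv s).continuousAt
  have hsupp' : HasCompactSupport v' := by
    have : v' = deriv v := funext fun s => (hv s).deriv.symm
    rw [this]; exact hsupp.deriv
  have i1 : Integrable fun s => l s * v s :=
    (hl.mul hvc).integrable_of_hasCompactSupport hsupp.mul_left
  have i2 : Integrable fun s => u s * v' s :=
    (huc.mul hv').integrable_of_hasCompactSupport hsupp'.mul_left
  have i3 : Integrable fun s => u s * v s :=
    (huc.mul hvc).integrable_of_hasCompactSupport hsupp.mul_left
  have h := integral_mul_deriv_eq_deriv_mul_of_integrable (fun s _ => hu s) (fun s _ => hv s)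
    i2 i1 i3
  rw [← ofReal_integral_eq_lintegral_ofReal i1
    (Eventually.of_forall fun s => mul_nonneg (hl0 s) (hv0 s))]
  simp_rw [← abs_mul]
  rw [← ofReal_integral_eq_lintegral_ofReal i2.abs (Eventually.of_forall fun s => abs_nonneg _)]
  refine ENNReal.ofReal_le_ofReal ?_
  calc ∫ s, l s * v s = -∫ s, u s * v' s := by rw [h, neg_neg]
    _ ≤ |∫ s, u s * v' s| := neg_le_abs _
    _ ≤ _ := abs_integral_le_integral_abs

theorem lintegral_mul_le_of_hasDerivAt_update {n : ℕ} (i : Fin n) {u l v v' : (Fin n → ℝ) → ℝ}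
    (hum : Measurable u) (hlm : Measurable l) (hvm : Measurable v) (hvm' : Measurable v')
    (hu : ∀ x, HasDerivAt (fun s => u (update x i s)) (l x) (x i))
    (hl : ∀ x, Continuous fun s => l (update x i s))
    (hv : ∀ x, HasDerivAt (fun s => v (update x i s)) (v' x) (x i))
    (hv' : ∀ x, Continuous fun s => v' (update x i s))
    (hsupp : HasCompactSupport v) (hl0 : ∀ s, 0 ≤ l s) (hv0 : ∀ s, 0 ≤ v s) :
    ∫⁻ x, ENNReal.ofReal (l x * v x) ≤ ∫⁻ x, ENNReal.ofReal (|u x| * |v' x|) := by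
  have hd : ∀ f g : (Fin n → ℝ) → ℝ, (∀ x, HasDerivAt (fun s => f (update x i s)) (g x) (x i)) →
      ∀ x s, HasDerivAt (fun s => f (update x i s)) (g (update x i s)) s := fun f g h x s => by
    simpa using h (update x i s)
  refine lintegral_le_of_lmarginal_le {i} (by fun_prop)
    (((continuous_abs.measurable.comp hum).mul
      (continuous_abs.measurable.comp hvm')).ennreal_ofReal) ?_
  rw [lmarginal_singleton, lmarginal_singleton]
  intro x
  refine integral_mul_le_of_hasCompactSupport (hd u l hu x) (hl x) (hd v v' hv x) (hv' x) ?_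
    (fun s => hl0 _) (fun s => hv0 _)
  refine HasCompactSupport.intro (K := (fun y : Fin n → ℝ => y i) '' tsupport v)
    (hsupp.isCompact.image (continuous_apply i)) fun s hs => ?_
  by_contra h
  exact hs ⟨update x i s, subset_tsupport _ h, by simp⟩

theorem prod_le_sum_div_pow {n : ℕ} (hn : 0 < n) {l : Fin n → ℝ} (hl : ∀ i, 0 ≤ l i) :
    ∏ i, l i ≤ ((∑ i, l i) / n) ^ n := by
  have hn' : (n : ℝ) ≠ 0 := by positivity
  have h := Real.geom_mean_le_arith_mean_weighted Finset.univ (fun _ => (n : ℝ)⁻¹) l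
    (fun _ _ => by positivity) (by simp [hn']) (fun i _ => hl i)
  rw [Real.finsetProd_rpow _ _ fun i _ => hl i, ← Finset.mul_sum] at h
  have := pow_le_pow_left₀
    (Real.rpow_nonneg (Finset.prod_nonneg fun i _ => hl i) _) h n
  rw [Real.rpow_inv_natCast_pow (Finset.prod_nonneg fun i _ => hl i) hn.ne'] at this
  rwa [div_eq_inv_mul]

theorem sum_abs_mul_abs_fderiv_le {n : ℕ} (v : EuclideanSpace ℝ (Fin n) → ℝ)
    (x z : EuclideanSpace ℝ (Fin n)) :
    ∑ i, |z i| * |fderiv ℝ v x (EuclideanSpace.single i 1)| ≤ ‖z‖ * ‖fderiv ℝ v x‖ := by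
  obtain ⟨g, hg⟩ := (InnerProductSpace.toDual ℝ (EuclideanSpace ℝ (Fin n))).surjective
    (fderiv ℝ v x)
  rw [← hg, LinearIsometryEquiv.norm_map, EuclideanSpace.norm_eq, EuclideanSpace.norm_eq]
  simp only [InnerProductSpace.toDual_apply_apply, EuclideanSpace.inner_single_right, one_mul,
    Real.norm_eq_abs]
  exact Real.sum_mul_le_sqrt_mul_sqrt _ _ _

theorem hasDerivAt_comp_toLp_update {n : ℕ} {v : EuclideanSpace ℝ (Fin n) → ℝ}
    (hv : Differentiable ℝ v) (i : Fin n) (x : Fin n → ℝ) :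
    HasDerivAt (fun s => v (WithLp.toLp 2 (update x i s)))
      (fderiv ℝ v (WithLp.toLp 2 x) (EuclideanSpace.single i 1)) (x i) := by
  have h1 : HasDerivAt (fun s => WithLp.toLp 2 (update x i s)) (EuclideanSpace.single i (1 : ℝ))
      (x i) :=
    ((PiLp.continuousLinearEquiv 2 ℝ fun _ : Fin n => ℝ).symm.hasFDerivAt).comp_hasDerivAt _
      (hasDerivAt_update x i (x i))
  have h2 := (hv (WithLp.toLp 2 (update x i (x i)))).hasFDerivAt.comp_hasDerivAt _ h1
  rw [update_eq_self] at h2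
  exact h2

theorem exists_euclidean_transport {n : ℕ} (hn : 0 < n) {F G : EuclideanSpace ℝ (Fin n) → ℝ}
    (hF : IsTameDensity fun y => F (WithLp.toLp 2 y))
    (hG : IsTameDensity fun y => G (WithLp.toLp 2 y)) (hFm : Measurable F) (hGm : Measurable G)
    (hFG : ∫⁻ x, ENNReal.ofReal (F x) = ∫⁻ x, ENNReal.ofReal (G x)) :
    ∃ (T : EuclideanSpace ℝ (Fin n) → EuclideanSpace ℝ (Fin n))
      (d : EuclideanSpace ℝ (Fin n) → ℝ), Measurable T ∧ Measurable d ∧ (∀ x, 0 ≤ d x) ∧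
      (∀ x, F x ≤ (d x / n) ^ n * G (T x)) ∧
      (∀ φ : EuclideanSpace ℝ (Fin n) → ℝ≥0∞, Measurable φ →
        ∫⁻ x, φ (T x) * ENNReal.ofReal (F x) = ∫⁻ x, φ x * ENNReal.ofReal (G x)) ∧
      ∀ v : EuclideanSpace ℝ (Fin n) → ℝ, ContDiff ℝ 1 v → HasCompactSupport v →
        (∀ x, 0 ≤ v x) →
        ∫⁻ x, ENNReal.ofReal (d x * v x) ≤ ∫⁻ x, ENNReal.ofReal (‖T x‖ * ‖fderiv ℝ v x‖) := by
  have hvp := PiLp.volume_preserving_toLp (Fin n)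
  have hlp : ∀ f : EuclideanSpace ℝ (Fin n) → ℝ≥0∞, Measurable f →
    ∫⁻ y : Fin n → ℝ, f (WithLp.toLp 2 y) = ∫⁻ x, f x := fun f hf => hvp.lintegral_comp hf
  obtain ⟨S, l, hS⟩ := exists_isTriangularTransport hF hG (by
    rw [hlp (fun x => ENNReal.ofReal (F x)) hFm.ennreal_ofReal,
      hlp (fun x => ENNReal.ofReal (G x)) hGm.ennreal_ofReal, hFG])
  have hof : Measurable (WithLp.ofLp : EuclideanSpace ℝ (Fin n) → Fin n → ℝ) :=
    (PiLp.continuous_ofLp 2 _).measurable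
  have hto : Measurable (WithLp.toLp 2 : (Fin n → ℝ) → EuclideanSpace ℝ (Fin n)) :=
    (PiLp.continuous_toLp 2 _).measurable
  have hT : Measurable fun x : EuclideanSpace ℝ (Fin n) => WithLp.toLp 2 (S x.ofLp) :=
    hto.comp (hS.measurable.comp hof)
  have hli : ∀ i, Measurable fun y => l y i := fun i =>
    (measurable_pi_apply i).comp hS.measurable_diag
  have hSi : ∀ i, Measurable fun y => S y i := fun i =>
    (measurable_pi_apply i).comp hS.measurable
  have hd : Measurable fun x : EuclideanSpace ℝ (Fin n) => ∑ i, l x.ofLp i :=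
    Finset.measurable_sum _ fun i _ => (hli i).comp hof
  refine ⟨fun x => WithLp.toLp 2 (S x.ofLp), fun x => ∑ i, l x.ofLp i, hT, hd,
    fun x => Finset.sum_nonneg fun i _ => hS.diag_nonneg _ i, fun x => ?_, fun φ hφ => ?_,
    fun v hv hsupp hv0 => ?_⟩
  · have := hS.density_eq x.ofLp
    simp only [WithLp.toLp_ofLp] at this
    rw [this]
    exact mul_le_mul_of_nonneg_right (prod_le_sum_div_pow hn (hS.diag_nonneg _)) (hG.pos _).le
  · rw [← hlp (fun x => φ (WithLp.toLp 2 (S x.ofLp)) * ENNReal.ofReal (F x)) (by fun_prop),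
      ← hlp (fun x => φ x * ENNReal.ofReal (G x)) (by fun_prop)]
    exact hS.lintegral_comp (fun y => φ (WithLp.toLp 2 y)) (hφ.comp hto)
  · have hvc := hv.continuous
    have hvd := hv.differentiable one_ne_zero
    have hfc : Continuous fun x => fderiv ℝ v x := hv.continuous_fderiv one_ne_zero
    have htoc : Continuous (WithLp.toLp 2 : (Fin n → ℝ) → EuclideanSpace ℝ (Fin n)) :=
      PiLp.continuous_toLp 2 _
    have hvt : Continuous fun y : Fin n → ℝ => v (WithLp.toLp 2 y) := hvc.comp htoc
    have hft : ∀ i, Continuous fun y : Fin n → ℝ =>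
        fderiv ℝ v (WithLp.toLp 2 y) (EuclideanSpace.single i 1) := fun i =>
      (hfc.comp htoc).clm_apply continuous_const
    have hst : HasCompactSupport fun y : Fin n → ℝ => v (WithLp.toLp 2 y) :=
      hsupp.comp_homeomorph (PiLp.homeomorph 2 fun _ : Fin n => ℝ).symm
    have hi := fun i => lintegral_mul_le_of_hasDerivAt_update i (hSi i) (hli i) hvt.measurable
      (hft i).measurable (fun x => hS.hasDerivAt x i) (fun x => hS.continuous_diag x i)
      (fun x => hasDerivAt_comp_toLp_update hvd i x)
      (fun x => (hft i).comp (continuous_const.update i continuous_id)) hst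
      (fun x => hS.diag_nonneg x i) (fun x => hv0 _)
    have hm : ∀ i, Measurable fun y => ENNReal.ofReal (l y i * v (WithLp.toLp 2 y)) := fun i =>
      ((hli i).mul hvt.measurable).ennreal_ofReal
    have hm' : ∀ i, Measurable fun y => ENNReal.ofReal
        (|S y i| * |fderiv ℝ v (WithLp.toLp 2 y) (EuclideanSpace.single i 1)|) := fun i =>
      ((continuous_abs.measurable.comp (hSi i)).mul
        (continuous_abs.measurable.comp (hft i).measurable)).ennreal_ofReal
    rw [← hlp (fun x => ENNReal.ofReal ((∑ i, l x.ofLp i) * v x))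
        (hd.mul hvc.measurable).ennreal_ofReal,
      ← hlp (fun x => ENNReal.ofReal (‖WithLp.toLp 2 (S x.ofLp)‖ * ‖fderiv ℝ v x‖))
        (hT.norm.mul hfc.measurable.norm).ennreal_ofReal]
    calc _ = ∫⁻ y, ∑ i, ENNReal.ofReal (l y i * v (WithLp.toLp 2 y)) :=
          lintegral_congr fun y => by
            rw [Finset.sum_mul, ENNReal.ofReal_sum_of_nonneg fun i _ =>
              mul_nonneg (hS.diag_nonneg _ i) (hv0 _)]
      _ = ∑ i, ∫⁻ y, ENNReal.ofReal (l y i * v (WithLp.toLp 2 y)) :=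
          lintegral_finsetSum _ fun i _ => hm i
      _ ≤ ∑ i, ∫⁻ y, ENNReal.ofReal
            (|S y i| * |fderiv ℝ v (WithLp.toLp 2 y) (EuclideanSpace.single i 1)|) :=
          Finset.sum_le_sum fun i _ => hi i
      _ = ∫⁻ y, ∑ i, ENNReal.ofReal
            (|S y i| * |fderiv ℝ v (WithLp.toLp 2 y) (EuclideanSpace.single i 1)|) :=
          (lintegral_finsetSum _ fun i _ => hm' i).symm
      _ ≤ _ := lintegral_mono fun y => by
          rw [← ENNReal.ofReal_sum_of_nonneg fun i _ => by positivity]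
          exact ENNReal.ofReal_le_ofReal
            (sum_abs_mul_abs_fderiv_le v (WithLp.toLp 2 y) (WithLp.toLp 2 (S y)))
end

section
open Set Filter Topology ENNReal Function

/-- A sequence of smooth cutoffs with gradients of size `O(1 / ‖x‖)`. -/
theorem exists_cutoff_seq (E : Type*) [NormedAddCommGroup E] [InnerProductSpace ℝ E]
    [FiniteDimensional ℝ E] :
    ∃ (χ : ℕ → E → ℝ) (L : ℝ), 0 ≤ L ∧ (∀ k, ContDiff ℝ 1 (χ k)) ∧
      (∀ k, HasCompactSupport (χ k)) ∧ (∀ k x, 0 ≤ χ k x) ∧ (∀ k x, χ k x ≤ 1) ∧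
      (∀ x, ∀ᶠ k in atTop, χ k x = 1) ∧ (∀ x, ∀ᶠ k in atTop, fderiv ℝ (χ k) x = 0) ∧
      ∀ k x, (1 + ‖x‖ ^ 2) * ‖fderiv ℝ (χ k) x‖ ≤ L * ‖x‖ := by
  let η : ContDiffBump (0 : E) := ⟨1, 2, one_pos, one_lt_two⟩
  have hη : ContDiff ℝ 1 η := η.contDiff
  obtain ⟨L, hL⟩ := (η.hasCompactSupport.fderiv (𝕜 := ℝ)).exists_bound_of_continuous
    (hη.continuous_fderiv one_ne_zero)
  have hL0 : 0 ≤ L := (norm_nonneg _).trans (hL 0)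
  let c : ℕ → ℝ := fun k => ((k : ℝ) + 1)⁻¹
  have hc0 : ∀ k, 0 < c k := fun k => by positivity
  have hc1 : ∀ k, c k ≤ 1 := fun k => inv_le_one_of_one_le₀ (by simp)
  have hsmall : ∀ x : E, ∀ᶠ k in atTop, ‖c k • x‖ < 1 := fun x => by
    have h1 : Tendsto c atTop (𝓝 0) := by
      simpa [c] using tendsto_one_div_add_atTop_nhds_zero_nat (𝕜 := ℝ)
    have h2 : Tendsto (fun k => ‖c k • x‖) atTop (𝓝 0) := by
      simpa using (h1.smul_const x).norm
    exact h2.eventually (gt_mem_nhds one_pos)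
  have hfd : ∀ k x, fderiv ℝ (fun x => η (c k • x)) x = c k • fderiv ℝ η (c k • x) := fun k x =>
    fderiv_comp_smul (c k)
  have hz : ∀ y : E, ‖y‖ < 1 → fderiv ℝ η y = 0 := fun y hy => by
    have : (η : E → ℝ) =ᶠ[𝓝 y] fun _ => 1 :=
      η.eventuallyEq_one_of_mem_ball (by simpa [η] using hy)
    rw [this.fderiv_eq]; simp
  have hz' : ∀ y : E, 2 < ‖y‖ → fderiv ℝ η y = 0 := fun y hy => by
    by_contra h
    have := support_fderiv_subset ℝ (f := η) h
    rw [η.tsupport_eq] at this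
    simp [η] at this
    linarith
  refine ⟨fun k x => η (c k • x), 3 * L, by positivity,
    fun k => hη.comp (contDiff_const_smul _), fun k => ?_, fun k x => η.nonneg, fun k x => η.le_one,
    fun x => ?_, fun x => ?_, fun k x => ?_⟩
  · exact η.hasCompactSupport.comp_smul (hc0 k).ne'
  · filter_upwards [hsmall x] with k hk
    exact η.one_of_mem_closedBall (by simpa [η] using hk.le)
  · filter_upwards [hsmall x] with k hk
    rw [hfd, hz _ hk, smul_zero]
  · rw [hfd, norm_smul, Real.norm_of_nonneg (hc0 k).le]
    have hn : ‖c k • x‖ = c k * ‖x‖ := by rw [norm_smul, Real.norm_of_nonneg (hc0 k).le]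
    rcases lt_or_ge ‖c k • x‖ 1 with h1 | h1
    · rw [hz _ h1]; simp; positivity
    rcases lt_or_ge 2 ‖c k • x‖ with h2 | h2
    · rw [hz' _ h2]; simp; positivity
    rw [hn] at h1 h2
    have h3 : (1 + ‖x‖ ^ 2) * c k ≤ 3 * ‖x‖ := by
      have : c k ≤ ‖x‖ := (hc1 k).trans (h1.trans
        (mul_le_of_le_one_left (norm_nonneg _) (hc1 k)))
      nlinarith [norm_nonneg x]
    calc (1 + ‖x‖ ^ 2) * (c k * ‖fderiv ℝ η (c k • x)‖)
        = (1 + ‖x‖ ^ 2) * c k * ‖fderiv ℝ η (c k • x)‖ := by ring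
      _ ≤ 3 * ‖x‖ * L := mul_le_mul h3 (hL _) (norm_nonneg _) (by positivity)
      _ = _ := by ring

/-- A weak divergence inequality for compactly supported test functions extends to test functions
with controlled decay. -/
theorem lintegral_mul_le_of_decay {E : Type*} [NormedAddCommGroup E] [InnerProductSpace ℝ E]
    [FiniteDimensional ℝ E] [MeasurableSpace E] [BorelSpace E] {μ : Measure E} {T : E → E}
    {d F h : E → ℝ} (hT : Measurable T) (hd : Measurable d)
    (hdiv : ∀ v : E → ℝ, ContDiff ℝ 1 v → HasCompactSupport v → (∀ x, 0 ≤ v x) →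
      ∫⁻ x, ENNReal.ofReal (d x * v x) ∂μ ≤ ∫⁻ x, ENNReal.ofReal (‖T x‖ * ‖fderiv ℝ v x‖) ∂μ)
    (hh : ContDiff ℝ 1 h) (hh0 : ∀ x, 0 ≤ h x) {C : ℝ} (hC : 0 ≤ C)
    (hhF : ∀ x, h x ≤ C * ((1 + ‖x‖ ^ 2) * F x)) (hF0 : ∀ x, 0 ≤ F x)
    (hfin : ∫⁻ x, ENNReal.ofReal (‖T x‖ * ‖x‖ * F x) ∂μ ≠ ∞) :
    ∫⁻ x, ENNReal.ofReal (d x * h x) ∂μ ≤ ∫⁻ x, ENNReal.ofReal (‖T x‖ * ‖fderiv ℝ h x‖) ∂μ := by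
  obtain ⟨χ, L, hL0, hχ, hχs, hχ0, hχ1, hχe, hχd, hχb⟩ := exists_cutoff_seq E
  have hhm := hh.continuous.measurable
  have hhd := (hh.continuous_fderiv one_ne_zero).measurable
  have hχm := fun k => (hχ k).continuous.measurable
  have hχdm := fun k => ((hχ k).continuous_fderiv one_ne_zero).measurable
  set I := ∫⁻ x, ENNReal.ofReal (‖T x‖ * ‖fderiv ℝ h x‖) ∂μ
  let e : ℕ → ℝ≥0∞ := fun k => ∫⁻ x, ENNReal.ofReal (‖T x‖ * (h x * ‖fderiv ℝ (χ k) x‖)) ∂μ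
  have he : Tendsto e atTop (𝓝 0) := by
    have := tendsto_lintegral_of_dominated_convergence (μ := μ)
      (F := fun k x => ENNReal.ofReal (‖T x‖ * (h x * ‖fderiv ℝ (χ k) x‖))) (f := fun _ => 0)
      (fun x => ENNReal.ofReal (C * L) * ENNReal.ofReal (‖T x‖ * ‖x‖ * F x))
      (fun k => (hT.norm.mul (hhm.mul (hχdm k).norm)).ennreal_ofReal)
      (fun k => Eventually.of_forall fun x => ?_) ?_ (Eventually.of_forall fun x => ?_)
    · rwa [lintegral_zero] at this
    · simp only
      rw [← ENNReal.ofReal_mul (by positivity)]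
      refine ENNReal.ofReal_le_ofReal ?_
      calc ‖T x‖ * (h x * ‖fderiv ℝ (χ k) x‖)
          ≤ ‖T x‖ * (C * ((1 + ‖x‖ ^ 2) * F x) * ‖fderiv ℝ (χ k) x‖) := by
            gcongr; exact hhF x
        _ = ‖T x‖ * (C * F x) * ((1 + ‖x‖ ^ 2) * ‖fderiv ℝ (χ k) x‖) := by ring
        _ ≤ ‖T x‖ * (C * F x) * (L * ‖x‖) := by
            have := hF0 x
            exact mul_le_mul_of_nonneg_left (hχb k x) (by positivity)
        _ = _ := by ring
    · rw [lintegral_const_mul' _ _ (by simp)]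
      exact ENNReal.mul_ne_top (by simp) hfin
    · refine tendsto_const_nhds.congr' ?_
      filter_upwards [hχd x] with k hk
      simp [hk]
  have hk : ∀ k, ∫⁻ x, ENNReal.ofReal (d x * (χ k x * h x)) ∂μ ≤ I + e k := fun k => by
    refine (hdiv _ ((hχ k).mul hh) ((hχs k).mul_right)
      fun x => mul_nonneg (hχ0 k x) (hh0 x)).trans ?_
    refine le_trans ?_ (lintegral_add_left
      (f := fun x => ENNReal.ofReal (‖T x‖ * ‖fderiv ℝ h x‖))
      (hT.norm.mul hhd.norm).ennreal_ofReal _).le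
    refine lintegral_mono fun x => ?_
    rw [← ENNReal.ofReal_add (by positivity)
      (mul_nonneg (norm_nonneg _) (mul_nonneg (hh0 x) (norm_nonneg _))), ← mul_add]
    refine ENNReal.ofReal_le_ofReal (mul_le_mul_of_nonneg_left ?_ (norm_nonneg _))
    rw [fderiv_fun_mul ((hχ k).differentiable one_ne_zero x) (hh.differentiable one_ne_zero x)]
    refine (norm_add_le _ _).trans ?_
    rw [norm_smul, norm_smul, Real.norm_of_nonneg (hχ0 k x), Real.norm_of_nonneg (hh0 x)]
    gcongr
    exact mul_le_of_le_one_left (norm_nonneg _) (hχ1 k x)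
  have hlim : Tendsto (fun k => I + e k) atTop (𝓝 I) := by
    simpa using tendsto_const_nhds.add he
  calc ∫⁻ x, ENNReal.ofReal (d x * h x) ∂μ
      = ∫⁻ x, liminf (fun k => ENNReal.ofReal (d x * (χ k x * h x))) atTop ∂μ := by
        refine lintegral_congr fun x => (Tendsto.liminf_eq ?_).symm
        refine tendsto_const_nhds.congr' ?_
        filter_upwards [hχe x] with k hk
        simp [hk]
    _ ≤ liminf (fun k => ∫⁻ x, ENNReal.ofReal (d x * (χ k x * h x)) ∂μ) atTop :=
        lintegral_liminf_le fun k => (hd.mul ((hχm k).mul hhm)).ennreal_ofReal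
    _ ≤ liminf (fun k => I + e k) atTop := liminf_le_liminf (Eventually.of_forall hk)
    _ = I := hlim.liminf_eq
end

section
open Set Filter Topology ENNReal Function

/-- The density of the round metric of the sphere in stereographic coordinates. -/
noncomputable def sphereDensity {n : ℕ} (x : EuclideanSpace ℝ (Fin n)) : ℝ :=
  ((1 + ‖x‖ ^ 2) / 2) ^ (-(n : ℝ))

/-- The conformal factor of the stereographic projection. -/
noncomputable def bubble {n : ℕ} (x : EuclideanSpace ℝ (Fin n)) : ℝ :=
  ((1 + ‖x‖ ^ 2) / 2) ^ (((2 : ℝ) - n) / 2)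

variable {n : ℕ}

theorem sphereDensity_pos (x : EuclideanSpace ℝ (Fin n)) : 0 < sphereDensity x :=
  Real.rpow_pos_of_pos (by positivity) _

theorem bubble_pos (x : EuclideanSpace ℝ (Fin n)) : 0 < bubble x :=
  Real.rpow_pos_of_pos (by positivity) _

theorem contDiff_one_add_norm_sq_rpow (s : ℝ) :
    ContDiff ℝ 1 fun x : EuclideanSpace ℝ (Fin n) => ((1 + ‖x‖ ^ 2) / 2) ^ s :=
  ((contDiff_const.add (contDiff_norm_sq ℝ)).div_const 2).rpow_const_of_ne
    fun x => by positivity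

theorem bubble_rpow (hn : 3 ≤ n) (x : EuclideanSpace ℝ (Fin n)) :
    bubble x ^ ((2 * (n : ℝ)) / ((n : ℝ) - 2)) = sphereDensity x := by
  have : (3 : ℝ) ≤ n := by exact_mod_cast hn
  have h2 : (n : ℝ) - 2 ≠ 0 := by linarith
  rw [bubble, ← Real.rpow_mul (by positivity), sphereDensity]
  congr 1
  field_simp
  ring

theorem norm_fderiv_bubble_sq (x : EuclideanSpace ℝ (Fin n)) :
    ‖fderiv ℝ bubble x‖ ^ 2 = (((n : ℝ) - 2) / 2) ^ 2 * (‖x‖ ^ 2 * sphereDensity x) := by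
  have hq : HasFDerivAt (fun x : EuclideanSpace ℝ (Fin n) => (1 + ‖x‖ ^ 2) / 2)
      (innerSL ℝ x) x := by
    have := ((hasStrictFDerivAt_norm_sq x).hasFDerivAt.const_add 1).mul_const (2⁻¹ : ℝ)
    refine (this.congr_fderiv ?_)
    ext y
    simp
  have hpos : 0 < (1 + ‖x‖ ^ 2) / 2 := by positivity
  have h := hq.rpow_const (p := ((2 : ℝ) - n) / 2) (Or.inl hpos.ne')
  have h' : HasFDerivAt bubble _ x := h
  rw [h'.fderiv, norm_smul, innerSL_apply_norm, mul_pow, Real.norm_eq_abs, sq_abs, mul_pow,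
    ← Real.rpow_natCast (_ ^ _), ← Real.rpow_mul hpos.le, sphereDensity]
  have : (((2 : ℝ) - n) / 2 - 1) * ((2 : ℕ) : ℝ) = -n := by push_cast; ring
  rw [this]
  ring

theorem integrable_one_add_norm_sq_rpow {s : ℝ} (hs : (n : ℝ) < 2 * s) :
    Integrable fun x : EuclideanSpace ℝ (Fin n) => ((1 + ‖x‖ ^ 2) / 2) ^ (-s) := by
  have h := (integrable_rpow_neg_one_add_norm_sq (E := EuclideanSpace ℝ (Fin n))
    (μ := volume) (r := 2 * s) (by simpa using hs)).div_const ((2 : ℝ) ^ (-s))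
  refine h.congr (Eventually.of_forall fun x => ?_)
  simp only
  rw [Real.div_rpow (by positivity) (by positivity)]
  congr 2
  ring

theorem integrable_sphereDensity (hn : 0 < n) :
    Integrable (sphereDensity : EuclideanSpace ℝ (Fin n) → ℝ) :=
  integrable_one_add_norm_sq_rpow (by
    have : (0 : ℝ) < n := by exact_mod_cast hn
    linarith)

theorem one_add_norm_sq_mul_sphereDensity (x : EuclideanSpace ℝ (Fin n)) :
    (1 + ‖x‖ ^ 2) / 2 * sphereDensity x = ((1 + ‖x‖ ^ 2) / 2) ^ (-((n : ℝ) - 1)) := by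
  have hpos : 0 < (1 + ‖x‖ ^ 2) / 2 := by positivity
  rw [sphereDensity, show -((n : ℝ) - 1) = 1 + -(n : ℝ) by ring, Real.rpow_add hpos, Real.rpow_one]

theorem integrable_one_add_norm_sq_mul_sphereDensity (hn : 3 ≤ n) :
    Integrable fun x : EuclideanSpace ℝ (Fin n) => (1 + ‖x‖ ^ 2) / 2 * sphereDensity x := by
  have : (3 : ℝ) ≤ n := by exact_mod_cast hn
  simp_rw [one_add_norm_sq_mul_sphereDensity]
  exact integrable_one_add_norm_sq_rpow (by linarith)

theorem continuous_sphereDensity : Continuous (sphereDensity : EuclideanSpace ℝ (Fin n) → ℝ) :=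
  (contDiff_one_add_norm_sq_rpow _).continuous

theorem contDiff_bubble : ContDiff ℝ 1 (bubble : EuclideanSpace ℝ (Fin n) → ℝ) :=
  contDiff_one_add_norm_sq_rpow _

theorem integrable_norm_sq_mul_sphereDensity (hn : 3 ≤ n) :
    Integrable fun x : EuclideanSpace ℝ (Fin n) => ‖x‖ ^ 2 * sphereDensity x := by
  refine ((integrable_one_add_norm_sq_mul_sphereDensity hn).const_mul 2).mono'
    ((continuous_norm.pow 2).mul continuous_sphereDensity).aestronglyMeasurable
    (Eventually.of_forall fun x => ?_)
  have := sphereDensity_pos x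
  rw [Real.norm_of_nonneg (by positivity)]
  nlinarith

theorem integral_one_add_norm_sq_mul_sphereDensity (hn : 3 ≤ n) :
    n * ∫ x : EuclideanSpace ℝ (Fin n), (1 + ‖x‖ ^ 2) / 2 * sphereDensity x =
      (n - 1) * ∫ x : EuclideanSpace ℝ (Fin n), ‖x‖ ^ 2 * sphereDensity x := by
  have : Nonempty (Fin n) := ⟨⟨0, by omega⟩⟩
  have hn3 : (3 : ℝ) ≤ n := by exact_mod_cast hn
  let f : ℝ → ℝ := fun r => n * ((1 + r ^ 2) / 2 * ((1 + r ^ 2) / 2) ^ (-(n : ℝ))) -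
    (n - 1) * (r ^ 2 * ((1 + r ^ 2) / 2) ^ (-(n : ℝ)))
  have hfn : Integrable fun x : EuclideanSpace ℝ (Fin n) => f ‖x‖ :=
    ((integrable_one_add_norm_sq_mul_sphereDensity hn).const_mul _).sub
      ((integrable_norm_sq_mul_sphereDensity hn).const_mul _)
  have h0 : ∫ x : EuclideanSpace ℝ (Fin n), f ‖x‖ = 0 := by
    rw [integral_fun_norm_addHaar]
    have hfi := (integrable_fun_norm_addHaar volume).1 hfn
    let Φ : ℝ → ℝ := fun r => r ^ n * ((1 + r ^ 2) / 2) ^ (1 - (n : ℝ))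
    have hd : ∀ r, HasDerivAt Φ (r ^ (n - 1) • f r) r := fun r => by
      have hpos : 0 < (1 + r ^ 2) / 2 := by positivity
      have h1 : HasDerivAt (fun r : ℝ => (1 + r ^ 2) / 2) r r := by
        have := ((hasDerivAt_pow 2 r).const_add 1).div_const 2
        simpa using this
      have h2 := (hasDerivAt_pow n r).mul (h1.rpow_const (p := 1 - (n : ℝ)) (Or.inl hpos.ne'))
      refine h2.congr_deriv ?_
      have e1 : ((1 + r ^ 2) / 2) ^ (1 - (n : ℝ)) =
          (1 + r ^ 2) / 2 * ((1 + r ^ 2) / 2) ^ (-(n : ℝ)) := by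
        rw [sub_eq_add_neg, Real.rpow_add hpos, Real.rpow_one]
      have e2 : 1 - (n : ℝ) - 1 = -n := by ring
      have e3 : r ^ n = r ^ (n - 1) * r := by rw [← pow_succ]; congr 1; omega
      rw [e1, e2, e3, smul_eq_mul]
      ring
    have hlim : Tendsto Φ atTop (𝓝 0) := by
      have hb : Tendsto (fun r : ℝ => (2 : ℝ) ^ ((n : ℝ) - 1) * r ^ (-((n : ℝ) - 2)))
          atTop (𝓝 0) := by
        simpa using (tendsto_rpow_neg_atTop (by linarith : 0 < (n : ℝ) - 2)).const_mul
          ((2 : ℝ) ^ ((n : ℝ) - 1))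
      refine squeeze_zero' ?_ ?_ hb
      · filter_upwards [eventually_ge_atTop 0] with r hr
        positivity
      · filter_upwards [eventually_gt_atTop 0] with r hr
        have h1 : ((1 + r ^ 2) / 2) ^ (1 - (n : ℝ)) ≤ (r ^ 2 / 2) ^ (1 - (n : ℝ)) :=
          Real.rpow_le_rpow_of_nonpos (by positivity) (by linarith) (by linarith)
        calc Φ r ≤ r ^ n * (r ^ 2 / 2) ^ (1 - (n : ℝ)) := by
              exact mul_le_mul_of_nonneg_left h1 (by positivity)
          _ = _ := by
            rw [Real.div_rpow (by positivity) (by positivity), ← Real.rpow_natCast r 2,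
              ← Real.rpow_natCast r n, ← Real.rpow_mul hr.le, div_eq_mul_inv,
              ← Real.rpow_neg (by positivity), ← mul_assoc, ← Real.rpow_add hr, mul_comm]
            congr 2
            · ring
            · push_cast; ring
    have := integral_Ioi_of_hasDerivAt_of_tendsto' (a := 0) (fun r _ => hd r)
      (by simpa using hfi) hlim
    have hΦ0 : Φ 0 = 0 := by simp [Φ]; left; omega
    simp only [finrank_euclideanSpace, Fintype.card_fin]
    rw [this, hΦ0]
    simp
  have h1 : ∫ x : EuclideanSpace ℝ (Fin n), f ‖x‖ =
      n * (∫ x : EuclideanSpace ℝ (Fin n), (1 + ‖x‖ ^ 2) / 2 * sphereDensity x) -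
      (n - 1) * ∫ x : EuclideanSpace ℝ (Fin n), ‖x‖ ^ 2 * sphereDensity x := by
    rw [← integral_const_mul, ← integral_const_mul]
    exact integral_sub ((integrable_one_add_norm_sq_mul_sphereDensity hn).const_mul _)
      ((integrable_norm_sq_mul_sphereDensity hn).const_mul _)
  linarith

theorem isTameDensity_of_le_sphereDensity {F : EuclideanSpace ℝ (Fin n) → ℝ} (hF : Continuous F)
    (hF0 : ∀ x, 0 < F x) {C : ℝ} (hC : 0 ≤ C) (hFC : ∀ x, F x ≤ C * sphereDensity x) :
    IsTameDensity fun y => F (WithLp.toLp 2 y) := by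
  refine ⟨hF.comp (PiLp.continuous_toLp 2 _), fun y => hF0 _, C * 2 ^ n, fun y => ?_⟩
  refine (hFC _).trans ?_
  rw [mul_assoc]
  refine mul_le_mul_of_nonneg_left ?_ hC
  have h1 : ∏ i, (1 + y i ^ 2) ≤ (1 + ‖WithLp.toLp 2 y‖ ^ 2) ^ n := by
    calc ∏ i, (1 + y i ^ 2) ≤ ∏ _i : Fin n, (1 + ‖WithLp.toLp 2 y‖ ^ 2) := by
          refine Finset.prod_le_prod (fun i _ => by positivity) fun i _ => ?_
          have := PiLp.norm_apply_le (p := 2) (WithLp.toLp 2 y) i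
          have h := pow_le_pow_left₀ (norm_nonneg _) this 2
          simp only [Real.norm_eq_abs, sq_abs] at h
          gcongr
      _ = _ := by simp
  rw [sphereDensity, Real.rpow_neg (by positivity), Real.rpow_natCast, div_pow, inv_div,
    Finset.prod_inv_distrib, div_eq_mul_inv]
  gcongr
end

section
open Set Filter Topology ENNReal Function
variable {n : ℕ}

/-- The mass transport inequality from a density comparable to the spherical one. -/
theorem exists_sphereDensity_transport (hn : 3 ≤ n) {F h : EuclideanSpace ℝ (Fin n) → ℝ}
    (hF : Continuous F) {a b : ℝ} (ha : 0 < a) (haF : ∀ x, a * sphereDensity x ≤ F x)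
    (hFb : ∀ x, F x ≤ b * sphereDensity x)
    (hFG : ∫ x, F x = ∫ x : EuclideanSpace ℝ (Fin n), sphereDensity x)
    (hh : ContDiff ℝ 1 h) (hhF : ∀ x, h x = F x ^ (1 - (n : ℝ)⁻¹)) :
    ∃ T : EuclideanSpace ℝ (Fin n) → EuclideanSpace ℝ (Fin n), Measurable T ∧
      ∫⁻ x, ENNReal.ofReal (‖T x‖ ^ 2 * F x) =
        ∫⁻ x : EuclideanSpace ℝ (Fin n), ENNReal.ofReal (‖x‖ ^ 2 * sphereDensity x) ∧
      ∫⁻ x : EuclideanSpace ℝ (Fin n),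
          ENNReal.ofReal (n * ((1 + ‖x‖ ^ 2) / 2 * sphereDensity x)) ≤
        ∫⁻ x, ENNReal.ofReal (‖T x‖ * ‖fderiv ℝ h x‖) := by
  have hG : ∀ x : EuclideanSpace ℝ (Fin n), 0 < sphereDensity x := sphereDensity_pos
  have hF0 : ∀ x, 0 < F x := fun x => (mul_pos ha (hG x)).trans_le (haF x)
  have hb : 0 < b := pos_of_mul_pos_left ((hF0 0).trans_le (hFb 0)) (hG 0).le
  have hn0 : (0 : ℝ) < n := by exact_mod_cast (by omega : 0 < n)
  have hGi := integrable_sphereDensity (n := n) (by omega)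
  have hFi : Integrable F := (hGi.const_mul b).mono' hF.aestronglyMeasurable
    (Eventually.of_forall fun x => by rw [Real.norm_of_nonneg (hF0 x).le]; exact hFb x)
  obtain ⟨T, d, hT, hd, hd0, hFd, hpush, hdiv⟩ := exists_euclidean_transport (by omega)
    (isTameDensity_of_le_sphereDensity hF hF0 hb.le hFb)
    (isTameDensity_of_le_sphereDensity continuous_sphereDensity hG zero_le_one
      fun x => (one_mul _).ge)
    hF.measurable continuous_sphereDensity.measurable (by
      rw [← ofReal_integral_eq_lintegral_ofReal hFi (Eventually.of_forall fun x => (hF0 x).le),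
        ← ofReal_integral_eq_lintegral_ofReal hGi (Eventually.of_forall fun x => (hG x).le), hFG])
  have hT2 : ∫⁻ x, ENNReal.ofReal (‖T x‖ ^ 2 * F x) =
      ∫⁻ x : EuclideanSpace ℝ (Fin n), ENNReal.ofReal (‖x‖ ^ 2 * sphereDensity x) := by
    have := hpush (fun x => ENNReal.ofReal (‖x‖ ^ 2)) (by fun_prop)
    simpa only [← ENNReal.ofReal_mul (sq_nonneg ‖_‖)] using this
  refine ⟨T, hT, hT2, ?_⟩
  have hM := integrable_norm_sq_mul_sphereDensity hn
  have hpt : ∀ x, n * ((1 + ‖T x‖ ^ 2) / 2) * F x ≤ d x * h x := fun x => by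
    have hq : 0 < (1 + ‖T x‖ ^ 2) / 2 := by positivity
    have h1 : F x ≤ (d x / (n * ((1 + ‖T x‖ ^ 2) / 2))) ^ n := by
      refine (hFd x).trans_eq ?_
      rw [sphereDensity, Real.rpow_neg hq.le, Real.rpow_natCast, ← inv_pow, ← mul_pow,
        ← div_eq_mul_inv, div_div]
    have h2 : F x ^ (n : ℝ)⁻¹ ≤ d x / (n * ((1 + ‖T x‖ ^ 2) / 2)) := by
      refine (Real.rpow_le_rpow (hF0 x).le h1 (by positivity)).trans_eq ?_
      exact Real.pow_rpow_inv_natCast (div_nonneg (hd0 x) (by positivity)) (by omega)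
    rw [le_div_iff₀ (by positivity)] at h2
    have h3 : F x = F x ^ (n : ℝ)⁻¹ * h x := by
      rw [hhF, ← Real.rpow_add (hF0 x)]
      simp
    have h4 : 0 ≤ h x := by rw [hhF]; exact Real.rpow_nonneg (hF0 x).le _
    calc n * ((1 + ‖T x‖ ^ 2) / 2) * F x
        = F x ^ (n : ℝ)⁻¹ * (n * ((1 + ‖T x‖ ^ 2) / 2)) * h x := by
          conv_lhs => rw [h3]
          ring
      _ ≤ d x * h x := mul_le_mul_of_nonneg_right h2 h4
  calc ∫⁻ x : EuclideanSpace ℝ (Fin n),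
        ENNReal.ofReal (n * ((1 + ‖x‖ ^ 2) / 2 * sphereDensity x))
      = ∫⁻ x : EuclideanSpace ℝ (Fin n),
          ENNReal.ofReal (n * ((1 + ‖x‖ ^ 2) / 2)) * ENNReal.ofReal (sphereDensity x) := by
        refine lintegral_congr fun x => ?_
        rw [← ENNReal.ofReal_mul (by positivity), mul_assoc]
    _ = ∫⁻ x, ENNReal.ofReal (n * ((1 + ‖T x‖ ^ 2) / 2)) * ENNReal.ofReal (F x) :=
        (hpush (fun x => ENNReal.ofReal (n * ((1 + ‖x‖ ^ 2) / 2))) (by fun_prop)).symm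
    _ ≤ ∫⁻ x, ENNReal.ofReal (d x * h x) := by
        refine lintegral_mono fun x => ?_
        rw [← ENNReal.ofReal_mul (by positivity)]
        exact ENNReal.ofReal_le_ofReal (hpt x)
    _ ≤ _ := ?_
  refine lintegral_mul_le_of_decay (F := F) (C := a ^ (-(n : ℝ)⁻¹)) hT hd hdiv hh
    (fun x => by rw [hhF]; exact Real.rpow_nonneg (hF0 x).le _) (by positivity) (fun x => ?_)
    (fun x => (hF0 x).le) ?_
  · have hq : 0 < (1 + ‖x‖ ^ 2) / 2 := by positivity
    have h1 : F x ^ (-(n : ℝ)⁻¹) ≤ a ^ (-(n : ℝ)⁻¹) * ((1 + ‖x‖ ^ 2) / 2) := by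
      refine (Real.rpow_le_rpow_of_nonpos (mul_pos ha (hG x)) (haF x)
        (neg_nonpos.2 (by positivity))).trans_eq ?_
      rw [Real.mul_rpow ha.le (hG x).le, sphereDensity, ← Real.rpow_mul hq.le, neg_mul_neg,
        mul_inv_cancel₀ hn0.ne', Real.rpow_one]
    have h2 : h x = F x ^ (-(n : ℝ)⁻¹) * F x := by
      rw [hhF, sub_eq_neg_add, Real.rpow_add (hF0 x), Real.rpow_one]
    have h3 : F x ^ (-(n : ℝ)⁻¹) ≤ a ^ (-(n : ℝ)⁻¹) * (1 + ‖x‖ ^ 2) :=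
      h1.trans (mul_le_mul_of_nonneg_left (by linarith) (by positivity))
    rw [h2, ← mul_assoc]
    exact mul_le_mul_of_nonneg_right h3 (hF0 x).le
  · refine ne_top_of_le_ne_top (ENNReal.add_ne_top.2 ⟨hM.lintegral_lt_top.ne,
      (hM.const_mul b).lintegral_lt_top.ne⟩) ?_
    rw [← hT2, ← lintegral_add_left (by fun_prop)]
    refine lintegral_mono fun x => ?_
    have := hF0 x
    rw [← ENNReal.ofReal_add (by positivity) (by have := hG x; positivity)]
    refine ENNReal.ofReal_le_ofReal ?_
    have h1 := mul_le_mul_of_nonneg_left (hFb x) (sq_nonneg ‖x‖)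
    nlinarith [mul_nonneg (hF0 x).le (sq_nonneg (‖T x‖ - ‖x‖)),
      mul_nonneg (hF0 x).le (sq_nonneg (‖T x‖)), mul_nonneg (hF0 x).le (sq_nonneg (‖x‖))]

/-- The sharp Sobolev inequality for functions comparable to the bubble. -/
theorem sobolev_of_comparable_bubble (hn : 3 ≤ n) {w : EuclideanSpace ℝ (Fin n) → ℝ}
    (hw : ContDiff ℝ 1 w) {a b : ℝ} (ha : 0 < a) (haw : ∀ x, a * bubble x ≤ w x)
    (hwb : ∀ x, w x ≤ b * bubble x) (hW : Integrable fun x => ‖fderiv ℝ w x‖ ^ 2) :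
    (∫ x : EuclideanSpace ℝ (Fin n), ‖fderiv ℝ bubble x‖ ^ 2) *
        (∫ x, w x ^ ((2 * (n : ℝ)) / ((n : ℝ) - 2))) ^ (((n : ℝ) - 2) / n) ≤
      (∫ x : EuclideanSpace ℝ (Fin n), sphereDensity x) ^ (((n : ℝ) - 2) / n) *
        ∫ x, ‖fderiv ℝ w x‖ ^ 2 := by
  have hn3 : (3 : ℝ) ≤ n := by exact_mod_cast hn
  have hn2 : (0 : ℝ) < n - 2 := by linarith
  have hn1 : (0 : ℝ) < n - 1 := by linarith
  have hn0 : (0 : ℝ) < n := by linarith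
  set p : ℝ := (2 * (n : ℝ)) / ((n : ℝ) - 2) with hp
  have hp0 : 0 < p := by positivity
  have hw0 : ∀ x, 0 < w x := fun x => (mul_pos ha (bubble_pos x)).trans_le (haw x)
  have hb : 0 < b := pos_of_mul_pos_left ((hw0 0).trans_le (hwb 0)) (bubble_pos 0).le
  have hGi := integrable_sphereDensity (n := n) (by omega)
  have hwp : Continuous fun x => w x ^ p :=
    hw.continuous.rpow_const fun x => Or.inr hp0.le
  have hlow : ∀ x, a ^ p * sphereDensity x ≤ w x ^ p := fun x => by
    rw [← bubble_rpow hn, ← Real.mul_rpow ha.le (bubble_pos x).le]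
    exact Real.rpow_le_rpow (mul_pos ha (bubble_pos x)).le (haw x) hp0.le
  have hupp : ∀ x, w x ^ p ≤ b ^ p * sphereDensity x := fun x => by
    rw [← bubble_rpow hn, ← Real.mul_rpow hb.le (bubble_pos x).le]
    exact Real.rpow_le_rpow (hw0 x).le (hwb x) hp0.le
  have hwi : Integrable fun x => w x ^ p := (hGi.const_mul (b ^ p)).mono'
    hwp.aestronglyMeasurable (Eventually.of_forall fun x => by
      rw [Real.norm_of_nonneg (Real.rpow_nonneg (hw0 x).le _)]; exact hupp x)
  set B := ∫ x : EuclideanSpace ℝ (Fin n), sphereDensity x with hBdef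
  set A := ∫ x, w x ^ p with hAdef
  have hB : 0 < B := integral_pos_of_integrable_nonneg_nonzero (x := 0) continuous_sphereDensity
    hGi (fun x => (sphereDensity_pos x).le) (sphereDensity_pos 0).ne'
  have hA : 0 < A := integral_pos_of_integrable_nonneg_nonzero (x := 0) hwp
    hwi (fun x => Real.rpow_nonneg (hw0 x).le _) (Real.rpow_pos_of_pos (hw0 0) _).ne'
  set c := B / A with hc
  have hc0 : 0 < c := div_pos hB hA
  set κ : ℝ := 2 * ((n : ℝ) - 1) / (n - 2) with hκ
  have hκ0 : 0 < κ := by positivity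
  have hF0 : ∀ x, 0 < c * w x ^ p := fun x => mul_pos hc0 (Real.rpow_pos_of_pos (hw0 x) _)
  obtain ⟨T, hT, hT2, hle⟩ := exists_sphereDensity_transport hn (F := fun x => c * w x ^ p)
    (h := fun x => c ^ (1 - (n : ℝ)⁻¹) * w x ^ κ) (hwp.const_mul c)
    (a := c * a ^ p) (b := c * b ^ p) (by positivity)
    (fun x => by rw [mul_assoc]; exact mul_le_mul_of_nonneg_left (hlow x) hc0.le)
    (fun x => by rw [mul_assoc]; exact mul_le_mul_of_nonneg_left (hupp x) hc0.le)
    (by rw [integral_const_mul]; exact div_mul_cancel₀ _ hA.ne')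
    (contDiff_const.mul (hw.rpow_const_of_ne fun x => (hw0 x).ne'))
    (fun x => by
      rw [Real.mul_rpow hc0.le (Real.rpow_nonneg (hw0 x).le _), ← Real.rpow_mul (hw0 x).le]
      congr 2
      rw [hκ, hp]
      field_simp)
  set W := ∫ x, ‖fderiv ℝ w x‖ ^ 2 with hWdef
  set s := c ^ (((n : ℝ) - 2) / n) with hs
  have hs0 : 0 < s := Real.rpow_pos_of_pos hc0 _
  have hgrad : ∀ x, ‖fderiv ℝ (fun x => c ^ (1 - (n : ℝ)⁻¹) * w x ^ κ) x‖ ^ 2 =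
      κ ^ 2 * s * ((c * w x ^ p) * ‖fderiv ℝ w x‖ ^ 2) := fun x => by
    have hd : HasFDerivAt w (fderiv ℝ w x) x :=
      (hw.differentiable one_ne_zero x).hasFDerivAt
    have h1 := (hd.rpow_const (p := κ) (Or.inl (hw0 x).ne')).const_mul (c ^ (1 - (n : ℝ)⁻¹))
    rw [h1.fderiv, norm_smul, norm_smul, mul_pow, mul_pow, Real.norm_eq_abs, Real.norm_eq_abs,
      sq_abs, sq_abs, mul_pow, ← Real.rpow_natCast (c ^ _), ← Real.rpow_natCast (w x ^ _),
      ← Real.rpow_mul hc0.le, ← Real.rpow_mul (hw0 x).le]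
    have e1 : (1 - (n : ℝ)⁻¹) * ((2 : ℕ) : ℝ) = ((n : ℝ) - 2) / n + 1 := by
      push_cast; field_simp; ring
    have e2 : (κ - 1) * ((2 : ℕ) : ℝ) = p := by
      rw [hκ, hp]; push_cast; field_simp; ring
    rw [e1, e2, Real.rpow_add_one hc0.ne']
    ring
  have hM := integrable_norm_sq_mul_sphereDensity hn
  have hQ := integrable_one_add_norm_sq_mul_sphereDensity hn
  set M := ∫ x : EuclideanSpace ℝ (Fin n), ‖x‖ ^ 2 * sphereDensity x with hMdef
  have hM0 : 0 ≤ M := integral_nonneg fun x =>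
    mul_nonneg (sq_nonneg _) (sphereDensity_pos x).le
  have hW0 : 0 ≤ W := integral_nonneg fun x => sq_nonneg _
  have hbound : ENNReal.ofReal ((n - 1) * M) ≤
      ENNReal.ofReal ((n - 1) / 2 * M + κ ^ 2 * s / (2 * (n - 1)) * W) := by
    calc ENNReal.ofReal ((n - 1) * M)
        = ∫⁻ x : EuclideanSpace ℝ (Fin n),
            ENNReal.ofReal (n * ((1 + ‖x‖ ^ 2) / 2 * sphereDensity x)) := by
          rw [← integral_one_add_norm_sq_mul_sphereDensity hn, ← integral_const_mul]
          refine ofReal_integral_eq_lintegral_ofReal (hQ.const_mul _)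
            (Eventually.of_forall fun x => ?_)
          have := sphereDensity_pos x
          positivity
      _ ≤ _ := hle
      _ ≤ ∫⁻ x, (ENNReal.ofReal ((n - 1) / 2) * ENNReal.ofReal (‖T x‖ ^ 2 * (c * w x ^ p)) +
            ENNReal.ofReal (κ ^ 2 * s / (2 * (n - 1)) * ‖fderiv ℝ w x‖ ^ 2)) := by
          refine lintegral_mono fun x => ?_
          have hFx := hF0 x
          rw [← ENNReal.ofReal_mul (by positivity), ← ENNReal.ofReal_add (by positivity)
            (by positivity)]
          refine ENNReal.ofReal_le_ofReal ?_
          refine abs_le_of_sq_le_sq' ?_ (by positivity) |>.2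
          rw [mul_pow, hgrad]
          have hid : ∀ t f g : ℝ, ((n - 1) / 2 * (t * f) + κ ^ 2 * s / (2 * (n - 1)) * g) ^ 2 -
              t * (κ ^ 2 * s * (f * g)) =
              ((n - 1) / 2 * (t * f) - κ ^ 2 * s / (2 * (n - 1)) * g) ^ 2 := fun t f g => by
            field_simp
            ring
          have := hid (‖T x‖ ^ 2) (c * w x ^ p) (‖fderiv ℝ w x‖ ^ 2)
          nlinarith [sq_nonneg ((n - 1) / 2 * (‖T x‖ ^ 2 * (c * w x ^ p)) -
            κ ^ 2 * s / (2 * (n - 1)) * ‖fderiv ℝ w x‖ ^ 2)]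
      _ = _ := by
          have hTm : Measurable fun x => ENNReal.ofReal (‖T x‖ ^ 2 * (c * w x ^ p)) :=
            ((hT.norm.pow_const 2).mul (hwp.measurable.const_mul c)).ennreal_ofReal
          rw [lintegral_add_left (hTm.const_mul _), lintegral_const_mul _ hTm, hT2,
            ← ofReal_integral_eq_lintegral_ofReal hM
              (Eventually.of_forall fun x => mul_nonneg (sq_nonneg _) (sphereDensity_pos x).le),
            ← ofReal_integral_eq_lintegral_ofReal (hW.const_mul _)
              (Eventually.of_forall fun x => by positivity), integral_const_mul,
            ← ENNReal.ofReal_mul (by positivity), ← ENNReal.ofReal_add (by positivity)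
              (by positivity)]
  rw [ENNReal.ofReal_le_ofReal_iff (by positivity)] at hbound
  have hmain : ((n - 2) / 2) ^ 2 * M ≤ s * W := by
    have h1 : (n - 1) / 2 * M ≤ κ ^ 2 * s / (2 * (n - 1)) * W := by linarith
    have h2 : κ ^ 2 * s / (2 * (n - 1)) * W = (n - 1) / 2 * ((2 / (n - 2)) ^ 2 * (s * W)) := by
      rw [hκ]; field_simp
    rw [h2] at h1
    have h3 := le_of_mul_le_mul_left h1 (by positivity)
    calc ((n - 2) / 2) ^ 2 * M ≤ ((n - 2) / 2) ^ 2 * ((2 / (n - 2)) ^ 2 * (s * W)) := by gcongr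
      _ = s * W := by field_simp
  simp_rw [norm_fderiv_bubble_sq]
  rw [integral_const_mul, ← hMdef]
  have hAs : 0 < A ^ (((n : ℝ) - 2) / n) := Real.rpow_pos_of_pos hA _
  rw [hs, hc, Real.div_rpow hB.le hA.le, div_mul_eq_mul_div, le_div_iff₀ hAs] at hmain
  exact hmain

end

section
open Set Filter Topology ENNReal Function

theorem norm_fderiv_sqrt_sq_add_sq_le {E : Type*} [NormedAddCommGroup E] [NormedSpace ℝ E]
    {u v : E → ℝ} {x : E} (hu : DifferentiableAt ℝ u x) (hv : DifferentiableAt ℝ v x)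
    (hx : v x ≠ 0) :
    ‖fderiv ℝ (fun y => √(u y ^ 2 + v y ^ 2)) x‖ ^ 2 ≤
      ‖fderiv ℝ u x‖ ^ 2 + ‖fderiv ℝ v x‖ ^ 2 := by
  have hpos : 0 < u x ^ 2 + v x ^ 2 := by positivity
  have h1 := ((hu.hasFDerivAt.pow 2).add (hv.hasFDerivAt.pow 2)).sqrt hpos.ne'
  have h2 : fderiv ℝ (fun y => √(u y ^ 2 + v y ^ 2)) x =
      (√(u x ^ 2 + v x ^ 2))⁻¹ • (u x • fderiv ℝ u x + v x • fderiv ℝ v x) := by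
    refine (HasFDerivAt.congr_fderiv h1 ?_).fderiv
    ext y
    simp
    ring
  have h3 : ‖u x • fderiv ℝ u x + v x • fderiv ℝ v x‖ ≤
      |u x| * ‖fderiv ℝ u x‖ + |v x| * ‖fderiv ℝ v x‖ := by
    refine (norm_add_le _ _).trans_eq ?_
    rw [norm_smul, norm_smul, Real.norm_eq_abs, Real.norm_eq_abs]
  have h4 := pow_le_pow_left₀ (norm_nonneg _) h3 2
  rw [h2, norm_smul, mul_pow, norm_inv, inv_pow, Real.norm_eq_abs, sq_abs, Real.sq_sqrt hpos.le,
    inv_mul_le_iff₀ hpos]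
  refine h4.trans ?_
  rw [← sq_abs (u x), ← sq_abs (v x)]
  nlinarith [sq_nonneg (|u x| * ‖fderiv ℝ v x‖ - |v x| * ‖fderiv ℝ u x‖)]

theorem norm_gradient {E : Type*} [NormedAddCommGroup E] [InnerProductSpace ℝ E] [CompleteSpace E]
    (f : E → ℝ) (x : E) : ‖gradient f x‖ = ‖fderiv ℝ f x‖ :=
  LinearIsometryEquiv.norm_map _ _

variable {n : ℕ}

theorem integrable_norm_fderiv_bubble_sq (hn : 3 ≤ n) :
    Integrable fun x : EuclideanSpace ℝ (Fin n) => ‖fderiv ℝ bubble x‖ ^ 2 := by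
  simp_rw [norm_fderiv_bubble_sq]
  exact (integrable_norm_sq_mul_sphereDensity hn).const_mul _

theorem exists_abs_le_mul_bubble {w : EuclideanSpace ℝ (Fin n) → ℝ} (hw : Continuous w)
    (hsupp : HasCompactSupport w) : ∃ K, 0 ≤ K ∧ ∀ x, |w x| ≤ K * bubble x := by
  obtain ⟨K, hK⟩ := (hsupp.mul_right (f' := fun x => (bubble x)⁻¹)).exists_bound_of_continuous
    (hw.mul (contDiff_bubble.continuous.inv₀ fun x => (bubble_pos x).ne'))
  refine ⟨K, (norm_nonneg _).trans (hK 0), fun x => ?_⟩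
  have := hK x
  rw [Pi.mul_apply, norm_mul, norm_inv, Real.norm_of_nonneg (bubble_pos x).le,
    ← div_eq_mul_inv, div_le_iff₀ (bubble_pos x)] at this
  exact this

/-- A perturbed form of the sharp Sobolev inequality for compactly supported functions. -/
theorem sobolev_add_sq_mul_bubble (hn : 3 ≤ n) {w : EuclideanSpace ℝ (Fin n) → ℝ}
    (hw : ContDiff ℝ 1 w) (hsupp : HasCompactSupport w) {ε : ℝ} (hε : 0 < ε) :
    (∫ x : EuclideanSpace ℝ (Fin n), ‖fderiv ℝ bubble x‖ ^ 2) *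
        (∫ x, |w x| ^ ((2 * (n : ℝ)) / ((n : ℝ) - 2))) ^ (((n : ℝ) - 2) / n) ≤
      (∫ x : EuclideanSpace ℝ (Fin n), sphereDensity x) ^ (((n : ℝ) - 2) / n) *
        ((∫ x, ‖fderiv ℝ w x‖ ^ 2) +
          ε ^ 2 * ∫ x : EuclideanSpace ℝ (Fin n), ‖fderiv ℝ bubble x‖ ^ 2) := by
  have hn3 : (3 : ℝ) ≤ n := by exact_mod_cast hn
  have hn2 : (0 : ℝ) < n - 2 := by linarith
  have hp0 : 0 < (2 * (n : ℝ)) / ((n : ℝ) - 2) := by positivity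
  obtain ⟨K, hK0, hK⟩ := exists_abs_le_mul_bubble hw.continuous hsupp
  have hψ : ∀ x : EuclideanSpace ℝ (Fin n), 0 < bubble x := bubble_pos
  let v : EuclideanSpace ℝ (Fin n) → ℝ := fun x => √(w x ^ 2 + (ε * bubble x) ^ 2)
  have hpos : ∀ x, 0 < w x ^ 2 + (ε * bubble x) ^ 2 := fun x => by
    have := hψ x
    positivity
  have hv : ContDiff ℝ 1 v :=
    ((hw.pow 2).add ((contDiff_const.mul contDiff_bubble).pow 2)).sqrt fun x => (hpos x).ne'
  have hav : ∀ x, ε * bubble x ≤ v x := fun x =>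
    Real.le_sqrt_of_sq_le (le_add_of_nonneg_left (sq_nonneg _))
  have hwv : ∀ x, |w x| ≤ v x := fun x =>
    Real.abs_le_sqrt (le_add_of_nonneg_right (sq_nonneg _))
  have hvb : ∀ x, v x ≤ (K + ε) * bubble x := fun x => by
    have := hψ x
    refine Real.sqrt_le_iff.2 ⟨by positivity, ?_⟩
    have h1 := pow_le_pow_left₀ (abs_nonneg _) (hK x) 2
    rw [sq_abs] at h1
    have : 0 ≤ K * ε * bubble x ^ 2 := by positivity
    nlinarith
  have hWs : HasCompactSupport fun x => ‖fderiv ℝ w x‖ ^ 2 :=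
    (hsupp.fderiv (𝕜 := ℝ)).comp_left
      (g := fun l : EuclideanSpace ℝ (Fin n) →L[ℝ] ℝ => ‖l‖ ^ 2) (by simp)
  have hWc : Continuous fun x => ‖fderiv ℝ w x‖ ^ 2 :=
    (hw.continuous_fderiv one_ne_zero).norm.pow 2
  have hWi : Integrable fun x => ‖fderiv ℝ w x‖ ^ 2 := hWc.integrable_of_hasCompactSupport hWs
  have hle : ∀ x, ‖fderiv ℝ v x‖ ^ 2 ≤ ‖fderiv ℝ w x‖ ^ 2 + ε ^ 2 * ‖fderiv ℝ bubble x‖ ^ 2 :=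
    fun x => by
      have hb := contDiff_bubble.differentiable one_ne_zero x
      have h1 := norm_fderiv_sqrt_sq_add_sq_le (hw.differentiable one_ne_zero x)
        (hb.const_mul ε) (mul_pos hε (hψ x)).ne'
      rwa [fderiv_const_mul hb, norm_smul, mul_pow, Real.norm_eq_abs, sq_abs] at h1
  have hsum : Integrable fun x =>
      ‖fderiv ℝ w x‖ ^ 2 + ε ^ 2 * ‖fderiv ℝ (bubble (n := n)) x‖ ^ 2 :=
    hWi.add ((integrable_norm_fderiv_bubble_sq hn).const_mul (ε ^ 2))
  have hVi : Integrable fun x => ‖fderiv ℝ v x‖ ^ 2 := hsum.mono'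
    ((hv.continuous_fderiv one_ne_zero).norm.pow 2).aestronglyMeasurable
    (Eventually.of_forall fun x => by rw [Real.norm_of_nonneg (sq_nonneg _)]; exact hle x)
  have hvi : Integrable fun x => v x ^ ((2 * (n : ℝ)) / ((n : ℝ) - 2)) :=
    ((integrable_sphereDensity (n := n) (by omega)).const_mul
      ((K + ε) ^ ((2 * (n : ℝ)) / ((n : ℝ) - 2)))).mono'
      (hv.continuous.rpow_const fun x => Or.inr hp0.le).aestronglyMeasurable
      (Eventually.of_forall fun x => by
        rw [Real.norm_of_nonneg (Real.rpow_nonneg (Real.sqrt_nonneg _) _), ← bubble_rpow hn,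
          ← Real.mul_rpow (by positivity) (hψ x).le]
        exact Real.rpow_le_rpow (Real.sqrt_nonneg _) (hvb x) hp0.le)
  have h1 := sobolev_of_comparable_bubble hn hv hε hav hvb hVi
  have hA : ∫ x, |w x| ^ ((2 * (n : ℝ)) / ((n : ℝ) - 2)) ≤
      ∫ x, v x ^ ((2 * (n : ℝ)) / ((n : ℝ) - 2)) :=
    integral_mono_of_nonneg (Eventually.of_forall fun x => Real.rpow_nonneg (abs_nonneg _) _) hvi
      (Eventually.of_forall fun x => Real.rpow_le_rpow (abs_nonneg _) (hwv x) hp0.le)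
  have hW : ∫ x, ‖fderiv ℝ v x‖ ^ 2 ≤ (∫ x, ‖fderiv ℝ w x‖ ^ 2) +
      ε ^ 2 * ∫ x : EuclideanSpace ℝ (Fin n), ‖fderiv ℝ bubble x‖ ^ 2 := by
    rw [← integral_const_mul, ← integral_add hWi
      ((integrable_norm_fderiv_bubble_sq hn).const_mul (ε ^ 2))]
    exact integral_mono hVi hsum hle
  have hWψ : 0 ≤ ∫ x : EuclideanSpace ℝ (Fin n), ‖fderiv ℝ bubble x‖ ^ 2 :=
    integral_nonneg fun x => sq_nonneg _
  have hB : 0 ≤ ∫ x : EuclideanSpace ℝ (Fin n), sphereDensity x :=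
    integral_nonneg fun x => (sphereDensity_pos x).le
  have hA0 : 0 ≤ ∫ x, |w x| ^ ((2 * (n : ℝ)) / ((n : ℝ) - 2)) :=
    integral_nonneg fun x => Real.rpow_nonneg (abs_nonneg _) _
  have hA' := Real.rpow_le_rpow hA0 hA (by positivity : 0 ≤ ((n : ℝ) - 2) / n)
  have h2 := mul_le_mul_of_nonneg_left hA' hWψ
  have h3 := mul_le_mul_of_nonneg_left hW (Real.rpow_nonneg hB (((n : ℝ) - 2) / n))
  exact (h2.trans h1).trans h3

/-- The sharp Sobolev inequality for compactly supported functions. -/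
theorem sobolev_bubble (hn : 3 ≤ n) {w : EuclideanSpace ℝ (Fin n) → ℝ}
    (hw : ContDiff ℝ 1 w) (hsupp : HasCompactSupport w) :
    (∫ x : EuclideanSpace ℝ (Fin n), ‖fderiv ℝ bubble x‖ ^ 2) *
        (∫ x, |w x| ^ ((2 * (n : ℝ)) / ((n : ℝ) - 2))) ^ (((n : ℝ) - 2) / n) ≤
      (∫ x : EuclideanSpace ℝ (Fin n), sphereDensity x) ^ (((n : ℝ) - 2) / n) *
        ∫ x, ‖fderiv ℝ w x‖ ^ 2 := by
  let f : ℝ → ℝ := fun ε =>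
    (∫ x : EuclideanSpace ℝ (Fin n), sphereDensity x) ^ (((n : ℝ) - 2) / n) *
      ((∫ x, ‖fderiv ℝ w x‖ ^ 2) +
        ε ^ 2 * ∫ x : EuclideanSpace ℝ (Fin n), ‖fderiv ℝ bubble x‖ ^ 2)
  have hf : Tendsto f (𝓝[>] 0) (𝓝 (f 0)) :=
    (Continuous.tendsto (by fun_prop) 0).mono_left nhdsWithin_le_nhds
  have h := ge_of_tendsto hf (by
    filter_upwards [self_mem_nhdsWithin] with ε hε
    exact sobolev_add_sq_mul_bubble hn hw hsupp hε)
  simpa [f] using h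

end

/-- **Sharp Sobolev inequality used at (3.7) in the proof of Lemma 3.2.** For `n ≥ 3`,
the function `ψ(x) = ((1+|x|²)/2)^{(2-n)/2}` minimizes the Sobolev quotient
`∫|∇u|² / (∫|u|^{2n/(n-2)})^{(n-2)/n}` among nonzero smooth compactly supported
functions on `ℝⁿ`. -/
theorem psi_minimizes_sobolev_quotient (n : ℕ) (hn : 3 ≤ n)
    (ψ : EuclideanSpace ℝ (Fin n) → ℝ)
    (hψ : ∀ x, ψ x = ((1 + ‖x‖^2)/2) ^ (((2:ℝ) - n)/2))
    (w : EuclideanSpace ℝ (Fin n) → ℝ)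
    (hw : ContDiff ℝ (⊤ : ℕ∞) w) (hsupp : HasCompactSupport w) (hne : w ≠ 0) :
    (∫ x, ‖gradient ψ x‖^2) / (∫ x, ψ x ^ ((2 * (n:ℝ))/((n:ℝ) - 2))) ^ (((n:ℝ) - 2)/(n:ℝ))
      ≤ (∫ x, ‖gradient w x‖^2) /
          (∫ x, |w x| ^ ((2 * (n:ℝ))/((n:ℝ) - 2))) ^ (((n:ℝ) - 2)/(n:ℝ)) := by
  obtain rfl : ψ = bubble := funext hψ
  have hn3 : (3 : ℝ) ≤ n := by exact_mod_cast hn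
  have hn2 : (0 : ℝ) < n - 2 := by linarith
  have hp0 : 0 < (2 * (n : ℝ)) / ((n : ℝ) - 2) := by positivity
  have hcont : Continuous fun x => |w x| ^ ((2 * (n : ℝ)) / ((n : ℝ) - 2)) :=
    hw.continuous.abs.rpow_const fun x => Or.inr hp0.le
  obtain ⟨x₀, hx₀⟩ := Function.ne_iff.1 hne
  have hA : 0 < ∫ x, |w x| ^ ((2 * (n : ℝ)) / ((n : ℝ) - 2)) :=
    integral_pos_of_integrable_nonneg_nonzero (x := x₀) hcont
      (hcont.integrable_of_hasCompactSupport (hsupp.comp_left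
        (g := fun t : ℝ => |t| ^ ((2 * (n : ℝ)) / ((n : ℝ) - 2))) (by simp [hp0.ne'])))
      (fun x => Real.rpow_nonneg (abs_nonneg _) _)
      (Real.rpow_pos_of_pos (abs_pos.2 hx₀) _).ne'
  have hB : 0 < ∫ x : EuclideanSpace ℝ (Fin n), sphereDensity x :=
    integral_pos_of_integrable_nonneg_nonzero (x := 0) continuous_sphereDensity
      (integrable_sphereDensity (by omega)) (fun x => (sphereDensity_pos x).le)
      (sphereDensity_pos 0).ne'
  simp_rw [norm_gradient, bubble_rpow hn]
  rw [div_le_div_iff₀ (Real.rpow_pos_of_pos hB _) (Real.rpow_pos_of_pos hA _)]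
  refine (sobolev_bubble hn (hw.of_le (by exact_mod_cast le_top)) hsupp).trans_eq (mul_comm _ _)
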